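/- arXiv:1004.3866 — 3 statements merged into one kernel-verified Lean document; each statement's English description precedes it below -/
import Mathlib

section
/- Let n ≥ 2 be an integer and m > 0 a real number. Let A be a symmetric n×n real matrix and v ∈ ℝⁿ a unit vector with A v = 0, and let y be any real number. Then (tr A − y)²/(m + n − 1) ≤ ∑_{i,j} A_{ij}² + y²/m. -/
theorem Matrix.sum_sq_sub_smul_projection {ι : Type*} [Fintype ι] [DecidableEq ι]
    (A : Matrix ι ι ℝ) (v : ι → ℝ) (hv : ∑ i, v i ^ 2 = 1) (hAv : A.mulVec v = 0) (s : ℝ) :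
    ∑ i, ∑ j, (A i j - s * ((1 : Matrix ι ι ℝ) i j - v i * v j)) ^ 2 =
      (∑ i, ∑ j, A i j ^ 2) - 2 * s * A.trace + s ^ 2 * (Fintype.card ι - 1) := by
  have row (i : ι) : ∑ j, (A i j - s * ((1 : Matrix ι ι ℝ) i j - v i * v j)) ^ 2 =
      (∑ j, A i j ^ 2) - 2 * s * A i i + s ^ 2 * (1 - v i ^ 2) := by
    have hAi : ∑ j, A i j * v j = 0 := congrFun hAv i
    have expand (j : ι) : (A i j - s * ((1 : Matrix ι ι ℝ) i j - v i * v j)) ^ 2 =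
        A i j ^ 2 + 2 * s * v i * (A i j * v j) + s ^ 2 * v i ^ 2 * v j ^ 2 +
          if i = j then -(2 * s * A i i) + s ^ 2 * (1 - 2 * v i ^ 2) else 0 := by
      rw [Matrix.one_apply]
      split_ifs with h
      · subst h
        ring
      · ring
    simp_rw [expand, Finset.sum_add_distrib, ← Finset.mul_sum, hAi, hv]
    simp only [Finset.sum_ite_eq, Finset.mem_univ, if_true]
    ring
  simp_rw [row, Finset.sum_add_distrib, Finset.sum_sub_distrib, ← Finset.mul_sum,
    Finset.sum_sub_distrib, hv]
  simp [Matrix.trace]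

theorem stmt_2 (n : ℕ) (hn : 2 ≤ n) (m : ℝ) (hm : 0 < m)
    (A : Matrix (Fin n) (Fin n) ℝ) (hA : A.IsSymm) (v : Fin n → ℝ)
    (hv : ∑ i, v i ^ 2 = 1) (hAv : A.mulVec v = 0) (y : ℝ) :
    (A.trace - y) ^ 2 / (m + n - 1) ≤ (∑ i, ∑ j, A i j ^ 2) + y ^ 2 / m := by
  have hn' : (2 : ℝ) ≤ n := by exact_mod_cast hn
  have hd : m + n - 1 ≠ 0 := by linarith
  obtain ⟨s, hs⟩ : ∃ s, s * (m + n - 1) = A.trace - y := ⟨_, div_mul_cancel₀ _ hd⟩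
  have hF : 0 ≤ (∑ i, ∑ j, A i j ^ 2) - 2 * s * A.trace + s ^ 2 * (n - 1) := by
    have h := A.sum_sq_sub_smul_projection v hv hAv s
    rw [Fintype.card_fin] at h
    rw [← h]
    positivity
  have hy : 0 ≤ y ^ 2 / m + 2 * s * y + m * s ^ 2 := by
    have h : y ^ 2 / m + 2 * s * y + m * s ^ 2 = (y + m * s) ^ 2 / m := by
      field_simp
      ring
    rw [h]
    positivity
  have hq : (A.trace - y) ^ 2 / (m + n - 1) = s * (A.trace - y) := by
    rw [← hs]
    field_simp
  rw [hq]
  linear_combination hF + hy + s * hs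
end

section
/- Let κ > 0 and T > 0 be real numbers. Let R : ℝ → ℝ be continuous on [0,T], and let φ : ℝ → ℝ be differentiable on (0,T) with φ'(t) + φ(t)²/κ + R(t) ≤ 0 for all t ∈ (0,T). Let h : ℝ → ℝ be continuously differentiable with h(0) = h(T) = 0, and assume that h(t)²·φ(t) → 0 as t → 0⁺ and that the functions t ↦ h(t)²·φ(t)², t ↦ h(t)·h'(t)·φ(t) and t ↦ h(t)²·φ'(t) are integrable on (0,T). Then ∫₀^T h(t)²·R(t) dt ≤ κ·∫₀^T h'(t)² dt. -/
open MeasureTheory intervalIntegral Set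

/-- A function comparable to something at least as singular as `(x - b)⁻¹` to the left of `b` is
not integrable on an interval ending at `b`. -/
theorem not_intervalIntegrable_of_sub_inv_isBigO_left {f : ℝ → ℝ} {a b : ℝ} (hab : a < b)
    (hf : (fun x => (x - b)⁻¹) =O[nhdsWithin b (Iio b)] f) :
    ¬ IntervalIntegrable f volume a b := by
  have hfilter : nhdsWithin b (uIcc a b \ {b}) = nhdsWithin b (Iio b) := by
    rw [uIcc_of_le hab.le, Icc_sdiff_right, nhdsWithin_Ico_eq_nhdsLT hab]
  have hderiv : ∀ x ∈ Iio b, HasDerivAt (fun x => Real.log (x - b)) (x - b)⁻¹ x := fun x hx => by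
    simpa using ((hasDerivAt_id x).sub_const b).log (sub_ne_zero.2 (ne_of_lt hx))
  refine not_intervalIntegrable_of_tendsto_norm_atTop_of_deriv_isBigO_within_sdiff_singleton
    (f := fun x => Real.log (x - b)) (c := b) hab.ne right_mem_uIcc ?_ ?_ ?_ <;> rw [hfilter]
  · filter_upwards [self_mem_nhdsWithin] with x hx using (hderiv x hx).differentiableAt
  · refine Filter.tendsto_abs_atBot_atTop.comp (Real.tendsto_log_nhdsNE_zero.comp ?_)
    refine tendsto_nhdsWithin_iff.2 ⟨?_, ?_⟩
    · have : Filter.Tendsto (fun x : ℝ => x - b) (nhds b) (nhds (b - b)) :=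
        (continuous_id.sub continuous_const).tendsto b
      rw [sub_self] at this
      exact this.mono_left nhdsWithin_le_nhds
    · filter_upwards [self_mem_nhdsWithin] with x hx using sub_ne_zero.2 (ne_of_lt hx)
  · refine hf.congr' ?_ Filter.EventuallyEq.rfl
    filter_upwards [self_mem_nhdsWithin] with x hx using (hderiv x hx).deriv.symm

/-- If `h` vanishes at `b` and is differentiable there, then integrability of `h² φ²` forces any
left limit of `h² φ` at `b` to be zero. -/
theorem eq_zero_of_tendsto_sq_mul_of_intervalIntegrable {h φ : ℝ → ℝ} {a b L d : ℝ} (hab : a < b)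
    (hd : HasDerivAt h d b) (hb : h b = 0)
    (hint : IntervalIntegrable (fun t => h t ^ 2 * φ t ^ 2) volume a b)
    (hL : Filter.Tendsto (fun t => h t ^ 2 * φ t) (nhdsWithin b (Iio b)) (nhds L)) :
    L = 0 := by
  by_contra hne
  refine not_intervalIntegrable_of_sub_inv_isBigO_left hab ?_ hint
  have hO : h =O[nhdsWithin b (Iio b)] (fun x => x - b) := by
    simpa [hb] using hd.isBigO_sub.mono (nhdsWithin_le_nhds (s := Iio b))
  have hone : (fun _ : ℝ => (1 : ℝ)) =O[nhdsWithin b (Iio b)] (fun t => h t ^ 2 * φ t) :=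
    (Asymptotics.isBigO_const_left_iff_pos_le_norm one_ne_zero).2
      ⟨‖L‖ / 2, by positivity,
        (hL.norm.eventually (lt_mem_nhds (half_lt_self (norm_pos_iff.2 hne)))).mono
          fun _ ht => ht.le⟩
  have hsub : (fun x => x - b) =O[nhdsWithin b (Iio b)] (fun _ => (1 : ℝ)) :=
    (((continuous_id.sub continuous_const).tendsto b).mono_left nhdsWithin_le_nhds).isBigO_one ℝ
  have hsq : (fun _ : ℝ => (1 : ℝ)) =O[nhdsWithin b (Iio b)]
      (fun t => (h t ^ 2 * φ t ^ 2) * (t - b) ^ 2) := by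
    refine ((hone.pow 2).trans
      ((Asymptotics.isBigO_refl (fun t => h t ^ 2 * φ t ^ 2) _).mul (hO.pow 2)
        |>.congr_left fun t => ?_)).congr_left fun t => one_pow 2
    ring
  refine (((Asymptotics.isBigO_refl (fun x => (x - b)⁻¹) _).mul hsq).trans ?_).congr_left
    fun t => mul_one _
  refine (((Asymptotics.isBigO_refl (fun t => h t ^ 2 * φ t ^ 2) _).mul hsub).congr' ?_ ?_)
  · filter_upwards [self_mem_nhdsWithin] with x hx
    have : x - b ≠ 0 := sub_ne_zero.2 (ne_of_lt hx)
    field_simp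
  · exact Filter.Eventually.of_forall fun x => mul_one _

/-- If `g` tends to zero at the left endpoint and has an integrable derivative, then it tends at
the right endpoint to the integral of its derivative. -/
theorem tendsto_integral_of_hasDerivAt_of_tendsto_zero {g g' : ℝ → ℝ} {a b : ℝ} (hab : a < b)
    (hg : ∀ t ∈ Ioo a b, HasDerivAt g (g' t) t) (hint : IntervalIntegrable g' volume a b)
    (ha : Filter.Tendsto g (nhdsWithin a (Ioi a)) (nhds 0)) :
    Filter.Tendsto g (nhdsWithin b (Iio b)) (nhds (∫ t in a..b, g' t)) := by
  have hcont := continuousOn_primitive_interval' hint left_mem_uIcc b right_mem_uIcc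
  rw [uIcc_of_le hab.le] at hcont
  have hlim := hcont.mono_left (nhdsWithin_mono b Ioo_subset_Icc_self)
  rw [nhdsWithin_Ioo_eq_nhdsLT hab] at hlim
  refine hlim.congr' ?_
  filter_upwards [Ioo_mem_nhdsLT hab] with t ht
  have hsub : uIcc a t ⊆ uIcc a b :=
    uIcc_subset_uIcc left_mem_uIcc (by rw [uIcc_of_le hab.le]; exact Ioo_subset_Icc_self ht)
  rw [integral_eq_sub_of_hasDerivAt_of_tendsto ht.1
    (fun x hx => hg x ⟨hx.1, hx.2.trans ht.2⟩) (hint.mono_set hsub) ha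
    ((hg t ht).continuousAt.tendsto.mono_left nhdsWithin_le_nhds), sub_zero]

theorem stmt_11 (κ T : ℝ) (hκ : 0 < κ) (hT : 0 < T)
    (R : ℝ → ℝ) (hR : ContinuousOn R (Icc 0 T))
    (φ φ' : ℝ → ℝ) (hφ : ∀ t ∈ Ioo 0 T, HasDerivAt φ (φ' t) t)
    (hineq : ∀ t ∈ Ioo 0 T, φ' t + φ t ^ 2 / κ + R t ≤ 0)
    (h h' : ℝ → ℝ) (hh : ∀ t, HasDerivAt h (h' t) t) (hh' : Continuous h')
    (h0 : h 0 = 0) (hTend : h T = 0)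
    (hlim : Filter.Tendsto (fun t => h t ^ 2 * φ t)
      (nhdsWithin 0 (Ioi 0)) (nhds 0))
    (hint1 : IntervalIntegrable (fun t => h t ^ 2 * φ t ^ 2) volume 0 T)
    (hint2 : IntervalIntegrable (fun t => h t * h' t * φ t) volume 0 T)
    (hint3 : IntervalIntegrable (fun t => h t ^ 2 * φ' t) volume 0 T) :
    ∫ t in (0:ℝ)..T, h t ^ 2 * R t ≤ κ * ∫ t in (0:ℝ)..T, h' t ^ 2 := by
  have hderiv : ∀ t ∈ Ioo 0 T, HasDerivAt (fun t => h t ^ 2 * φ t)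
      (2 * (h t * h' t * φ t) + h t ^ 2 * φ' t) t := fun t ht =>
    (((hh t).pow 2).mul (hφ t ht)).congr_deriv (by simp; ring)
  have hzero : ∫ t in (0:ℝ)..T, (2 * (h t * h' t * φ t) + h t ^ 2 * φ' t) = 0 :=
    eq_zero_of_tendsto_sq_mul_of_intervalIntegrable hT (hh T) hTend hint1
      (tendsto_integral_of_hasDerivAt_of_tendsto_zero hT hderiv
        ((hint2.const_mul 2).add hint3) hlim)
  have hcont : Continuous h := continuous_iff_continuousAt.2 fun t => (hh t).continuousAt
  have hintR : IntervalIntegrable (fun t => h t ^ 2 * R t) volume 0 T := by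
    refine ContinuousOn.intervalIntegrable ?_
    rw [uIcc_of_le hT.le]
    exact (hcont.pow 2).continuousOn.mul hR
  have hinth' : IntervalIntegrable (fun t => κ * h' t ^ 2) volume 0 T :=
    (continuous_const.mul (hh'.pow 2)).intervalIntegrable _ _
  have hintd := (hint2.const_mul 2).add hint3
  have hmono : ∫ t in (0:ℝ)..T, h t ^ 2 * R t ≤ ∫ t in (0:ℝ)..T,
      (κ * h' t ^ 2 - (2 * (h t * h' t * φ t) + h t ^ 2 * φ' t)) := by
    refine integral_mono_on_of_le_Ioo hT.le hintR (hinth'.sub hintd) fun t ht => ?_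
    have hriccati := mul_le_mul_of_nonneg_left (hineq t ht) (sq_nonneg (h t))
    have hsq : 0 ≤ (κ * h' t - h t * φ t) ^ 2 / κ := by positivity
    have hexpand : (κ * h' t - h t * φ t) ^ 2 / κ
        = κ * h' t ^ 2 - 2 * (h t * h' t * φ t) + h t ^ 2 * (φ t ^ 2 / κ) := by
      field_simp
      ring
    linarith
  rwa [integral_sub hinth' hintd, hzero, sub_zero, intervalIntegral.integral_const_mul] at hmono
end

section
/- Let κ > 0, c > 0, G ≥ 0 and L > 0 be real numbers. Let R : ℝ → ℝ be continuous on [0,L] and g : ℝ → ℝ be differentiable on [0,L] with |g(t)| ≤ G and R(t) ≥ κ·(c² + g'(t)) for all t ∈ [0,L]. If ∫₀^L sin²(πt/L)·R(t) dt ≤ κπ²/(2L), then c²L² − 4GL − π² ≤ 0. -/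
open MeasureTheory Set Real

/-- A lower bound for `∫ h² R` when `R ≥ κ (k + g')`, obtained by integrating `h² g'` by parts and
replacing `g` with the constant `s` in the term `2 h h' g`. The derivative `g'` need not be
integrable. -/
theorem mul_sub_le_integral_sq_mul {κ k s a b : ℝ} {h h' H R g g' : ℝ → ℝ} (hκ : 0 ≤ κ)
    (hab : a ≤ b) (hR : ContinuousOn R (Icc a b))
    (hh : ∀ t, HasDerivAt h (h' t) t) (hH : ∀ t, HasDerivAt H (h t ^ 2) t)
    (hg : ∀ t ∈ Icc a b, HasDerivWithinAt g (g' t) (Icc a b) t)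
    (hRge : ∀ t ∈ Icc a b, κ * (k + g' t) ≤ R t)
    (hs : ∀ t ∈ Icc a b, h t * h' t * g t ≤ h t * h' t * s) :
    κ * (k * (H b - H a) + h b ^ 2 * (g b - s) - h a ^ 2 * (g a - s)) ≤
      ∫ t in a..b, h t ^ 2 * R t := by
  have hcont : Continuous h := continuous_iff_continuousAt.2 fun t => (hh t).continuousAt
  have hF : ∀ t ∈ Icc a b, HasDerivWithinAt (fun t => κ * (k * H t + h t ^ 2 * (g t - s)))
      (κ * (k * h t ^ 2 + (2 * h t * h' t * (g t - s) + h t ^ 2 * g' t))) (Icc a b) t := by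
    intro t ht
    have hsq : HasDerivAt (fun t => h t ^ 2) (2 * h t * h' t) t := by
      simpa using (hh t).fun_pow 2
    exact (((hH t).hasDerivWithinAt.const_mul k).add
      (hsq.hasDerivWithinAt.mul ((hg t ht).sub_const s))).const_mul κ
  have key := intervalIntegral.sub_le_integral_of_hasDeriv_right_of_le
    (φ := fun t => h t ^ 2 * R t) hab (fun t ht => (hF t ht).continuousWithinAt)
    (fun t ht => ((hF t (Ioo_subset_Icc_self ht)).hasDerivAt
      (Icc_mem_nhds ht.1 ht.2)).hasDerivWithinAt)
    (((hcont.pow 2).continuousOn.mul hR).integrableOn_Icc)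
    (fun t ht => by
      have ht' := Ioo_subset_Icc_self ht
      have h1 := mul_le_mul_of_nonneg_left (hRge t ht') (sq_nonneg (h t))
      have h2 := mul_le_mul_of_nonneg_left (hs t ht') hκ
      linarith)
  linarith

theorem stmt_12 (κ c G L : ℝ) (hκ : 0 < κ) (hc : 0 < c) (hG : 0 ≤ G)
    (hL : 0 < L) (R : ℝ → ℝ) (hR : ContinuousOn R (Icc 0 L))
    (g g' : ℝ → ℝ) (hg : ∀ t ∈ Icc 0 L, HasDerivWithinAt g (g' t) (Icc 0 L) t)
    (hgG : ∀ t ∈ Icc 0 L, |g t| ≤ G)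
    (hRge : ∀ t ∈ Icc 0 L, R t ≥ κ * (c ^ 2 + g' t))
    (hint : ∫ t in (0:ℝ)..L, Real.sin (π * t / L) ^ 2 * R t ≤ κ * π ^ 2 / (2 * L)) :
    c ^ 2 * L ^ 2 - 4 * G * L - π ^ 2 ≤ 0 := by
  have hπ := pi_pos
  have hsub₁ : Icc 0 (L / 2) ⊆ Icc 0 L := Icc_subset_Icc_right (by linarith)
  have hsub₂ : Icc (L / 2) L ⊆ Icc 0 L := Icc_subset_Icc_left (by linarith)
  have hlin : ∀ t, HasDerivAt (fun t => π * t / L) (π / L) t := fun t => by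
    simpa using ((hasDerivAt_id t).const_mul π).div_const L
  have hsin : ∀ t, HasDerivAt (fun t => sin (π * t / L)) (cos (π * t / L) * (π / L)) t :=
    fun t => (hlin t).sin
  have hH : ∀ t, HasDerivAt
      (fun t => t / 2 - L / (2 * π) * (sin (π * t / L) * cos (π * t / L)))
      (sin (π * t / L) ^ 2) t := fun t => by
    refine (((hasDerivAt_id t).div_const 2).sub
      (((hsin t).mul (hlin t).cos).const_mul (L / (2 * π)))).congr_deriv ?_
    have := sin_sq_add_cos_sq (π * t / L)
    field_simp
    linear_combination -this
  have hsin_nonneg : ∀ t ∈ Icc 0 L, 0 ≤ sin (π * t / L) := fun t ht => by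
    have := ht.1
    refine sin_nonneg_of_nonneg_of_le_pi (by positivity) ?_
    rw [div_le_iff₀ hL]
    exact mul_le_mul_of_nonneg_left ht.2 hπ.le
  have first_half := mul_sub_le_integral_sq_mul (s := G) hκ.le (by linarith) (hR.mono hsub₁)
    hsin hH (fun t ht => (hg t (hsub₁ ht)).mono hsub₁) (fun t ht => hRge t (hsub₁ ht))
    (fun t ht => by
      have hcos : 0 ≤ cos (π * t / L) := by
        have := ht.1
        refine cos_nonneg_of_neg_pi_div_two_le_of_le (by
          have : 0 ≤ π * t / L := by positivity
          linarith) ?_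
        rw [div_le_iff₀ hL]
        nlinarith [ht.2]
      have := hsin_nonneg t (hsub₁ ht)
      exact mul_le_mul_of_nonneg_left (abs_le.1 (hgG t (hsub₁ ht))).2 (by positivity))
  have second_half := mul_sub_le_integral_sq_mul (s := -G) hκ.le (by linarith) (hR.mono hsub₂)
    hsin hH (fun t ht => (hg t (hsub₂ ht)).mono hsub₂) (fun t ht => hRge t (hsub₂ ht))
    (fun t ht => by
      have hcos : cos (π * t / L) ≤ 0 := by
        refine cos_nonpos_of_pi_div_two_le_of_le ?_ ?_
        · rw [le_div_iff₀ hL]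
          nlinarith [ht.1]
        · rw [div_le_iff₀ hL]
          nlinarith [ht.2]
      exact mul_le_mul_of_nonpos_left (abs_le.1 (hgG t (hsub₂ ht))).1
        (mul_nonpos_of_nonneg_of_nonpos (hsin_nonneg t (hsub₂ ht))
          (mul_nonpos_of_nonpos_of_nonneg hcos (by positivity))))
  have hcont : ContinuousOn (fun t => sin (π * t / L) ^ 2 * R t) (Icc 0 L) :=
    (by fun_prop : Continuous fun t => sin (π * t / L) ^ 2).continuousOn.mul hR
  have hsplit := intervalIntegral.integral_add_adjacent_intervals
    ((hcont.mono hsub₁).intervalIntegrable_of_Icc (μ := volume) (by linarith))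
    ((hcont.mono hsub₂).intervalIntegrable_of_Icc (μ := volume) (by linarith))
  have hmid : π * (L / 2) / L = π / 2 := by field_simp
  have hend : π * L / L = π := by field_simp
  simp only [hmid, hend, mul_zero, zero_div, sin_zero, cos_zero, sin_pi_div_two, cos_pi_div_two,
    sin_pi, cos_pi] at first_half second_half
  have hbound : κ * (c ^ 2 * L / 2 - 2 * G) ≤ κ * (π ^ 2 / (2 * L)) := by
    rw [← mul_div_assoc]
    linarith
  have hdiv := le_of_mul_le_mul_left hbound hκ
  rw [le_div_iff₀ (by positivity)] at hdiv
  linarith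
end
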